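/- arXiv:0706.0570 — 10 statements merged into one kernel-verified Lean document; each statement's English description precedes it below -/
import Mathlib

section
/- Let L be a bounded distributive lattice and n ≥ 1. For every weighted lattice polynomial function p : L^n → L there exists a set function α : 2^[n] → L such that for all x ∈ L^n, p(x) = ⋁_{S ⊆ [n]} ( α(S) ∧ ⋀_{i ∈ S} x_i ), where the meet over the empty index set equals 1. -/
/-- Weighted lattice polynomial (w.l.p.) functions from `L^n` to `L`: the smallest
class containing all coordinate projections and all constant functions, and closed
under pointwise `⊓` and `⊔`. -/
inductive IsWLP {L : Type*} [Lattice L] {n : ℕ} : ((Fin n → L) → L) → Prop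
  | proj (k : Fin n) : IsWLP (fun x => x k)
  | const (c : L) : IsWLP (fun _ => c)
  | inf {p q : (Fin n → L) → L} : IsWLP p → IsWLP q → IsWLP (fun x => p x ⊓ q x)
  | sup {p q : (Fin n → L) → L} : IsWLP p → IsWLP q → IsWLP (fun x => p x ⊔ q x)

/-- The characteristic vector `e_S` of `S ⊆ [n]`: its `i`-th component is `1` (top)
if `i ∈ S` and `0` (bottom) otherwise. -/
def charVec (L : Type*) [Lattice L] [BoundedOrder L] {n : ℕ} (S : Finset (Fin n)) :
    Fin n → L :=
  fun i => if i ∈ S then ⊤ else ⊥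

/-- Disjunctive normal form of a weighted lattice polynomial function: there is a
set function `α : 2^[n] → L` such that `p x = ⋁_{S ⊆ [n]} (α S ⊓ ⋀_{i ∈ S} x i)`. -/
theorem wlp_disjunctive_normal_form
    {L : Type*} [DistribLattice L] [BoundedOrder L] {n : ℕ} (hn : 1 ≤ n)
    (p : (Fin n → L) → L) (hp : IsWLP p) :
    ∃ α : Finset (Fin n) → L,
      ∀ x : Fin n → L,
        p x = Finset.univ.sup (fun S : Finset (Fin n) => α S ⊓ S.inf x) := by
  induction hp with
  | proj k =>
    refine ⟨fun S => if S = {k} then ⊤ else ⊥, fun x => le_antisymm ?_ ?_⟩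
    · refine le_trans ?_ (Finset.le_sup (Finset.mem_univ {k}))
      simp
    · refine Finset.sup_le fun S _ => ?_
      by_cases h : S = {k} <;> simp [h]
  | const c =>
    refine ⟨fun S => if S = ∅ then c else ⊥, fun x => le_antisymm ?_ ?_⟩
    · refine le_trans ?_ (Finset.le_sup (Finset.mem_univ ∅))
      simp
    · refine Finset.sup_le fun S _ => ?_
      by_cases h : S = ∅ <;> simp [h]
  | inf _ _ hp hq =>
    obtain ⟨α, hα⟩ := hp
    obtain ⟨β, hβ⟩ := hq
    refine ⟨fun S => (Finset.univ.filter fun P : Finset (Fin n) × Finset (Fin n) =>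
      P.1 ∪ P.2 = S).sup fun P => α P.1 ⊓ β P.2, fun x => ?_⟩
    simp only [hα, hβ]
    rw [Finset.sup_inf_sup]
    simp only [Finset.sup_inf_distrib_right]
    refine le_antisymm (Finset.sup_le fun P _ => ?_)
      (Finset.sup_le fun S _ => Finset.sup_le fun P hP => ?_)
    · refine le_trans ?_ (Finset.le_sup (Finset.mem_univ (P.1 ∪ P.2)))
      refine le_trans ?_ (Finset.le_sup (b := P) (by simp))
      rw [Finset.inf_union, inf_inf_inf_comm]
    · obtain rfl : P.1 ∪ P.2 = S := (Finset.mem_filter.mp hP).2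
      rw [Finset.inf_union, inf_inf_inf_comm]
      exact Finset.le_sup (f := fun P : Finset (Fin n) × Finset (Fin n) =>
        (α P.1 ⊓ P.1.inf x) ⊓ (β P.2 ⊓ P.2.inf x)) (by simp)
  | sup _ _ hp hq =>
    obtain ⟨α, hα⟩ := hp
    obtain ⟨β, hβ⟩ := hq
    refine ⟨fun S => α S ⊔ β S, fun x => ?_⟩
    simp only [hα, hβ, inf_sup_right]
    exact Finset.sup_sup.symm
end

section
/- Let L be a bounded distributive lattice and n ≥ 1. For every weighted lattice polynomial function p : L^n → L there exists a set function β : 2^[n] → L such that for all x ∈ L^n, p(x) = ⋀_{S ⊆ [n]} ( β(S) ∨ ⋁_{i ∈ S} x_i ), where the join over the empty index set equals 0. -/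
/-- Conjunctive normal form of a weighted lattice polynomial function: there is a
set function `β : 2^[n] → L` such that `p x = ⋀_{S ⊆ [n]} (β S ⊔ ⋁_{i ∈ S} x i)`. -/
theorem wlp_conjunctive_normal_form
    {L : Type*} [DistribLattice L] [BoundedOrder L] {n : ℕ} (hn : 1 ≤ n)
    (p : (Fin n → L) → L) (hp : IsWLP p) :
    ∃ β : Finset (Fin n) → L,
      ∀ x : Fin n → L,
        p x = Finset.univ.inf (fun S : Finset (Fin n) => β S ⊔ S.sup x) := by
  clear hn
  induction hp with
  | proj k =>
    refine ⟨fun S => if S = {k} then ⊥ else ⊤, fun x => eq_of_forall_le_iff fun a => ?_⟩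
    rw [Finset.le_inf_iff]
    refine ⟨fun h S _ => ?_, fun h => by simpa using h {k} (Finset.mem_univ _)⟩
    dsimp only
    split_ifs with hS
    · simpa [hS] using h
    · simp
  | const c =>
    refine ⟨fun _ => c, fun x => eq_of_forall_le_iff fun a => ?_⟩
    rw [Finset.le_inf_iff]
    exact ⟨fun h S _ => le_sup_of_le_left h, fun h => by simpa using h ∅ (Finset.mem_univ _)⟩
  | inf _ _ ihp ihq =>
    obtain ⟨β, hβ⟩ := ihp
    obtain ⟨γ, hγ⟩ := ihq
    refine ⟨fun S => β S ⊓ γ S, fun x => ?_⟩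
    simp_rw [hβ, hγ, sup_inf_right]
    exact Finset.inf_inf.symm
  | sup _ _ ihp ihq =>
    obtain ⟨β, hβ⟩ := ihp
    obtain ⟨γ, hγ⟩ := ihq
    refine ⟨fun U => (Finset.univ.filter fun P : Finset (Fin n) × Finset (Fin n) =>
      P.1 ∪ P.2 = U).inf fun P => β P.1 ⊔ γ P.2, fun x => ?_⟩
    dsimp only
    rw [hβ, hγ, Finset.inf_sup_inf]
    simp_rw [Finset.inf_sup_distrib_right]
    refine eq_of_forall_le_iff fun a => ?_
    simp only [Finset.le_inf_iff, Finset.mem_univ, Finset.mem_product, Finset.mem_filter, Prod.forall,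
      true_and, and_self, forall_const, sup_sup_sup_comm]
    exact ⟨by rintro h _ S T rfl; simpa [Finset.sup_union] using h S T,
      fun h S T => by simpa [Finset.sup_union] using h _ S T rfl⟩
end

section
/- Let L be a bounded distributive lattice and n ≥ 1, and let p : L^n → L be a weighted lattice polynomial function. Then for all x ∈ L^n, p(x) = ⋁_{S ⊆ [n]} ( α_p(S) ∧ ⋀_{i ∈ S} x_i ), where α_p(S) := p(e_S); i.e., p = p^∨_{α_p}. -/
theorem IsWLP.monotone {L : Type*} [Lattice L] {n : ℕ} {p : (Fin n → L) → L}
    (hp : IsWLP p) : Monotone p := by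
  induction hp with
  | proj k => exact fun _ _ h => h k
  | const c => exact monotone_const
  | inf _ _ hp hq => exact hp.inf hq
  | sup _ _ hp hq => exact hp.sup hq

theorem charVec_mono (L : Type*) [Lattice L] [BoundedOrder L] {n : ℕ} :
    Monotone (charVec L : Finset (Fin n) → Fin n → L) := by
  intro S T h i
  by_cases hS : i ∈ S
  · simp [charVec, hS, h hS]
  · simp [charVec, hS]

/-- Lemma (first part): any w.l.p. function `p` equals `p^∨_{α_p}`, where
`α_p S := p (e_S)`. -/
theorem wlp_eq_disjunctive_form_of_alpha_p
    {L : Type*} [DistribLattice L] [BoundedOrder L] {n : ℕ} (hn : 1 ≤ n)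
    (p : (Fin n → L) → L) (hp : IsWLP p) (x : Fin n → L) :
    p x = Finset.univ.sup (fun S : Finset (Fin n) => p (charVec L S) ⊓ S.inf x) := by
  induction hp with
  | proj k =>
    apply le_antisymm
    · refine le_trans ?_ (Finset.le_sup (Finset.mem_univ {k}))
      simp [charVec]
    · refine Finset.sup_le fun S _ => ?_
      by_cases hk : k ∈ S
      · exact inf_le_right.trans (Finset.inf_le hk)
      · simp [charVec, hk]
  | const c =>
    apply le_antisymm
    · refine le_trans ?_ (Finset.le_sup (Finset.mem_univ ∅))
      simp
    · exact Finset.sup_le fun S _ => inf_le_left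
  | @inf p q hp hq ihp ihq =>
    beta_reduce
    apply le_antisymm
    · rw [ihp, ihq, Finset.sup_inf_sup]
      refine Finset.sup_le fun ⟨S, T⟩ _ => ?_
      refine le_trans ?_ (Finset.le_sup (Finset.mem_univ (S ∪ T)))
      rw [Finset.inf_union, inf_inf_inf_comm]
      gcongr
      · exact hp.monotone (charVec_mono L Finset.subset_union_left)
      · exact hq.monotone (charVec_mono L Finset.subset_union_right)
    · rw [ihp, ihq]
      exact le_inf
        (Finset.sup_mono_fun fun S _ => inf_le_inf_right _ inf_le_left)
        (Finset.sup_mono_fun fun S _ => inf_le_inf_right _ inf_le_right)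
  | sup _ _ ihp ihq =>
    simp only [inf_sup_right]
    rw [ihp, ihq, ← Finset.sup_sup]
    rfl
end

section
/- Let L be a bounded distributive lattice and n ≥ 1. If p, q : L^n → L are weighted lattice polynomial functions such that p(e_S) = q(e_S) for every S ⊆ [n], then p = q. In other words, every n-ary weighted lattice polynomial function is entirely determined by its restriction to the characteristic vectors {0,1}^n. -/
/-- Below `a`, a w.l.p. function cannot distinguish a coordinate equal to `a` from `⊤`. -/
theorem IsWLP.update_inf {L : Type*} [DistribLattice L] [BoundedOrder L] {n : ℕ}
    {p : (Fin n → L) → L} (hp : IsWLP p) (x : Fin n → L) (k : Fin n) (a : L) :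
    a ⊓ p (Function.update x k a) = a ⊓ p (Function.update x k ⊤) := by
  induction hp with
  | proj j =>
    obtain rfl | hj := eq_or_ne j k
    · simp
    · simp [hj]
  | const c => rfl
  | inf _ _ ihp ihq => rw [inf_inf_distrib_left, ihp, ihq, ← inf_inf_distrib_left]
  | sup _ _ ihp ihq => rw [inf_sup_left, ihp, ihq, ← inf_sup_left]

/-- Above `a`, a w.l.p. function cannot distinguish a coordinate equal to `a` from `⊥`. -/
theorem IsWLP.update_sup {L : Type*} [DistribLattice L] [BoundedOrder L] {n : ℕ}
    {p : (Fin n → L) → L} (hp : IsWLP p) (x : Fin n → L) (k : Fin n) (a : L) :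
    a ⊔ p (Function.update x k a) = a ⊔ p (Function.update x k ⊥) := by
  induction hp with
  | proj j =>
    obtain rfl | hj := eq_or_ne j k
    · simp
    · simp [hj]
  | const c => rfl
  | inf _ _ ihp ihq => rw [sup_inf_left, ihp, ihq, ← sup_inf_left]
  | sup _ _ ihp ihq => rw [sup_sup_distrib_left, ihp, ihq, ← sup_sup_distrib_left]

/-- Two w.l.p. functions agree at a vector if they agree after replacing any one coordinate
by `⊥` and by `⊤`. -/
theorem IsWLP.eq_of_update_eq {L : Type*} [DistribLattice L] [BoundedOrder L] {n : ℕ}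
    {p q : (Fin n → L) → L} (hp : IsWLP p) (hq : IsWLP q) (x : Fin n → L) (k : Fin n)
    (hbot : p (Function.update x k ⊥) = q (Function.update x k ⊥))
    (htop : p (Function.update x k ⊤) = q (Function.update x k ⊤)) :
    p x = q x := by
  have hpi := hp.update_inf x k (x k)
  have hqi := hq.update_inf x k (x k)
  have hps := hp.update_sup x k (x k)
  have hqs := hq.update_sup x k (x k)
  rw [Function.update_eq_self] at hpi hqi hps hqs
  refine eq_of_inf_eq_sup_eq (a := x k) ?_ ?_
  · rw [inf_comm, hpi, htop, ← hqi, inf_comm]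
  · rw [sup_comm, hps, hbot, ← hqs, sup_comm]

/-- Any `n`-ary w.l.p. function is entirely determined by its restriction to the
characteristic vectors: if two w.l.p. functions agree on all `e_S`, they are equal. -/
theorem wlp_determined_by_characteristic_vectors
    {L : Type*} [DistribLattice L] [BoundedOrder L] {n : ℕ} (hn : 1 ≤ n)
    (p q : (Fin n → L) → L) (hp : IsWLP p) (hq : IsWLP q)
    (h : ∀ S : Finset (Fin n), p (charVec L S) = q (charVec L S)) :
    p = q := by
  have key : ∀ (s : Finset (Fin n)) (x : Fin n → L),
      (∀ i ∉ s, x i = ⊥ ∨ x i = ⊤) → p x = q x := by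
    intro s
    induction s using Finset.induction_on with
    | empty =>
      intro x hx
      classical
      have hx' : x = charVec L {i | x i = ⊤} := by
        funext i
        by_cases hi : x i = ⊤
        · simp [charVec, hi]
        · simpa [charVec, hi] using hx i (Finset.notMem_empty i)
      rw [hx']
      exact h _
    | insert k s _ ih =>
      intro x hx
      have hupdate (b : L) (hb : b = ⊥ ∨ b = ⊤) :
          p (Function.update x k b) = q (Function.update x k b) := by
        refine ih _ fun i hi => ?_
        obtain rfl | hik := eq_or_ne i k
        · simpa using hb
        · simpa [hik] using hx i (by simp [hik, hi])
      exact hp.eq_of_update_eq hq x k (hupdate ⊥ (Or.inl rfl)) (hupdate ⊤ (Or.inr rfl))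
  funext x
  exact key Finset.univ x fun i hi => absurd (Finset.mem_univ i) hi
end

section
/- Let L be a bounded distributive totally ordered lattice (a bounded chain), n ≥ 1, let p : L^n → L be a weighted lattice polynomial function, and let α : 2^[n] → L be any set function. Then p^∨_α = p if and only if α*_p ≤ α ≤ α_p pointwise, where α_p(S) := p(e_S) and α*_p(S) := α_p(S) if α_p(S) > α_p(S∖{i}) for every i ∈ S, and α*_p(S) := 0 otherwise. -/
theorem IsWLP.le_charVec {L : Type*} [LinearOrder L] [BoundedOrder L] {n : ℕ}
    {p : (Fin n → L) → L} (hp : IsWLP p) {t : L} {x : Fin n → L} (h : t ≤ p x) :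
    t ≤ p (charVec L (Finset.univ.filter fun i => t ≤ x i)) := by
  induction hp with
  | proj k => simp [charVec, h]
  | const c => exact h
  | inf _ _ ihp ihq => exact le_inf (ihp (le_inf_iff.1 h).1) (ihq (le_inf_iff.1 h).2)
  | sup _ _ ihp ihq => exact le_sup_iff.2 ((le_sup_iff.1 h).imp ihp ihq)

theorem IsWLP.le_of_le_charVec {L : Type*} [LinearOrder L] [BoundedOrder L] {n : ℕ}
    {p : (Fin n → L) → L} (hp : IsWLP p) {t : L} {x : Fin n → L} {S : Finset (Fin n)}
    (hS : ∀ i ∈ S, t ≤ x i) (h : t ≤ p (charVec L S)) : t ≤ p x := by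
  induction hp with
  | proj k =>
    by_cases hk : k ∈ S
    · exact hS k hk
    · exact le_trans (by simpa [charVec, hk] using h) bot_le
  | const c => exact h
  | inf _ _ ihp ihq => exact le_inf (ihp (le_inf_iff.1 h).1) (ihq (le_inf_iff.1 h).2)
  | sup _ _ ihp ihq => exact le_sup_iff.2 ((le_sup_iff.1 h).imp ihp ihq)

theorem IsWLP.charVec_mono {L : Type*} [LinearOrder L] [BoundedOrder L] {n : ℕ}
    {p : (Fin n → L) → L} (hp : IsWLP p) {S T : Finset (Fin n)} (h : S ⊆ T) :
    p (charVec L S) ≤ p (charVec L T) :=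
  hp.le_of_le_charVec (fun i hi => by simp [charVec, h hi]) le_rfl

/-- On a bounded chain, `p^∨_α = p` iff `α*_p ≤ α ≤ α_p`, where `α_p S = p (e_S)`
and `α*_p S = α_p S` if `α_p (S \ {i}) < α_p S` for all `i ∈ S`, else `α*_p S = 0`. -/
theorem wlp_disjunctive_defining_set_functions
    {L : Type*} [LinearOrder L] [BoundedOrder L] {n : ℕ} (hn : 1 ≤ n)
    (p : (Fin n → L) → L) (hp : IsWLP p) (α : Finset (Fin n) → L) :
    (∀ x : Fin n → L,
        Finset.univ.sup (fun S : Finset (Fin n) => α S ⊓ S.inf x) = p x) ↔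
      (∀ S : Finset (Fin n),
        (if ∀ i ∈ S, p (charVec L (S.erase i)) < p (charVec L S)
          then p (charVec L S) else (⊥ : L)) ≤ α S ∧ α S ≤ p (charVec L S)) := by
  constructor
  · intro h
    have hα : ∀ S, α S ≤ p (charVec L S) := fun S => by
      rw [← h]
      refine le_trans (le_inf le_rfl (Finset.le_inf fun i hi => ?_))
        (Finset.le_sup (f := fun T : Finset (Fin n) => α T ⊓ T.inf (charVec L S))
          (Finset.mem_univ S))
      simp [charVec, hi]
    refine fun S => ⟨?_, hα S⟩
    split_ifs with hS
    · obtain ⟨T, -, hT⟩ := Finset.exists_mem_eq_sup Finset.univ Finset.univ_nonempty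
        (fun T : Finset (Fin n) => α T ⊓ T.inf (charVec L S))
      have hle : p (charVec L S) ≤ α T ⊓ T.inf (charVec L S) := (h _).symm.trans hT |>.le
      by_cases hTS : T ⊆ S
      · by_cases hST : S ⊆ T
        · rw [hTS.antisymm hST] at hle
          exact hle.trans inf_le_left
        · obtain ⟨i, hiS, hiT⟩ := Finset.not_subset.1 hST
          exact absurd (hS i hiS) (not_lt.2 ((hle.trans inf_le_left).trans ((hα T).trans
            (hp.charVec_mono (Finset.subset_erase.2 ⟨hTS, hiT⟩)))))
      · obtain ⟨i, hiT, hiS⟩ := Finset.not_subset.1 hTS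
        have hbot : p (charVec L S) ≤ charVec L S i :=
          (hle.trans inf_le_right).trans (Finset.inf_le hiT)
        exact hbot.trans (by simp [charVec, hiS])
    · exact bot_le
  · intro h x
    apply le_antisymm
    · exact Finset.sup_le fun S _ => hp.le_of_le_charVec
        (fun i hi => inf_le_right.trans (Finset.inf_le hi)) (inf_le_left.trans (h S).2)
    · obtain ⟨S, hST, hS⟩ := exists_minimal_le_of_wellFoundedLT
        (fun S => p x ≤ p (charVec L S)) _ (hp.le_charVec (le_refl (p x)))
      have hα := (h S).1
      rw [if_pos fun i hi => (not_le.1 (hS.not_prop_of_lt (Finset.erase_ssubset hi))).trans_le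
        hS.prop] at hα
      refine le_trans (le_inf (hS.prop.trans hα) (Finset.le_inf fun i hi => ?_))
        (Finset.le_sup (f := fun S : Finset (Fin n) => α S ⊓ S.inf x) (Finset.mem_univ S))
      exact (Finset.mem_filter.1 (hST hi)).2
end

section
/- Let L be a bounded distributive lattice, n ≥ 1, let p : L^n → L be a weighted lattice polynomial function, and let α : 2^[n] → L be a set function with p^∨_α = p. If α is isotone (S ⊆ T implies α(S) ≤ α(T)), then α = α_p, where α_p(S) := p(e_S). In particular, α_p is the unique isotone set function that disjunctively defines p. -/
theorem charVec_inf_eq_bot {L : Type*} [Lattice L] [BoundedOrder L] {n : ℕ}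
    {S T : Finset (Fin n)} (h : ¬ T ⊆ S) : T.inf (charVec L S) = ⊥ := by
  obtain ⟨i, hiT, hiS⟩ := Finset.not_subset.mp h
  exact le_bot_iff.mp ((Finset.inf_le hiT).trans_eq (if_neg hiS))

theorem charVec_inf_self (L : Type*) [Lattice L] [BoundedOrder L] {n : ℕ}
    (S : Finset (Fin n)) : S.inf (charVec L S) = ⊤ :=
  top_le_iff.mp (Finset.le_inf fun _ hi => (if_pos hi).ge)

/-- `α_p` is the unique isotone set function disjunctively defining a w.l.p.
function `p`: if `p^∨_α = p` and `α` is isotone, then `α = α_p` where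
`α_p S := p (e_S)`. -/
theorem wlp_unique_isotone_disjunctive_set_function
    {L : Type*} [DistribLattice L] [BoundedOrder L] {n : ℕ} (hn : 1 ≤ n)
    (p : (Fin n → L) → L) (hp : IsWLP p) (α : Finset (Fin n) → L)
    (hα : ∀ x : Fin n → L,
      Finset.univ.sup (fun S : Finset (Fin n) => α S ⊓ S.inf x) = p x)
    (hiso : ∀ S T : Finset (Fin n), S ⊆ T → α S ≤ α T) :
    ∀ S : Finset (Fin n), α S = p (charVec L S) := by
  intro S
  rw [← hα]
  apply le_antisymm
  · calc α S = α S ⊓ S.inf (charVec L S) := by rw [charVec_inf_self, inf_top_eq]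
      _ ≤ _ := Finset.le_sup (f := fun T => α T ⊓ T.inf (charVec L S)) (Finset.mem_univ S)
  · refine Finset.sup_le fun T _ => ?_
    by_cases h : T ⊆ S
    · exact inf_le_left.trans (hiso T S h)
    · simp [charVec_inf_eq_bot h]
end

section
/- Let L be a bounded distributive lattice and n ≥ 1. For every weighted lattice polynomial function p : L^n → L there exists an L-valued fuzzy measure μ on [n] such that for all x ∈ L^n, p(x) = median( p(e_∅), S_μ(x), p(e_{[n]}) ), where median(a, b, c) = (a ∧ b) ∨ (b ∧ c) ∨ (a ∧ c). -/
namespace IsWLP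

variable {L : Type*} [DistribLattice L] {n : ℕ} {p : (Fin n → L) → L}

/-- A w.l.p. function, cut off at `m`, is monotone with respect to the pointwise order
of vectors cut off at `m`. -/
theorem inf_le_of_inf_le (hp : IsWLP p) {x y : Fin n → L} {m : L}
    (h : ∀ i, y i ⊓ m ≤ x i) : p y ⊓ m ≤ p x := by
  induction hp with
  | proj k => exact h k
  | const c => exact inf_le_left
  | inf _ _ hp hq =>
    exact le_inf ((inf_le_inf_right m inf_le_left).trans hp)
      ((inf_le_inf_right m inf_le_right).trans hq)
  | sup _ _ hp hq =>
    rw [inf_sup_right]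
    exact sup_le_sup hp hq

theorem monotone_s11 (hp : IsWLP p) : Monotone p := by
  intro x y hxy
  simpa using hp.inf_le_of_inf_le (m := p x) fun i => inf_le_left.trans (hxy i)

variable [BoundedOrder L]

theorem charVec_mono_s11 {S T : Finset (Fin n)} (h : S ⊆ T) : charVec L S ≤ charVec L T := by
  intro i
  by_cases hi : i ∈ S
  · simp [charVec, hi, h hi]
  · simp [charVec, hi]

theorem apply_charVec_inf_le (hp : IsWLP p) (S : Finset (Fin n)) (x : Fin n → L) :
    p (charVec L S) ⊓ S.inf x ≤ p x := by
  refine hp.inf_le_of_inf_le fun i => ?_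
  by_cases hi : i ∈ S
  · exact inf_le_right.trans (Finset.inf_le hi)
  · simp [charVec, hi]

/-- The disjunctive normal form of a w.l.p. function. -/
theorem eq_sup_charVec (hp : IsWLP p) (x : Fin n → L) :
    p x = Finset.univ.sup fun S : Finset (Fin n) => p (charVec L S) ⊓ S.inf x := by
  refine le_antisymm ?_ (Finset.sup_le fun S _ => hp.apply_charVec_inf_le S x)
  induction hp with
  | proj k =>
    refine le_trans ?_ (Finset.le_sup (Finset.mem_univ {k}))
    simp [charVec]
  | const c =>
    refine le_trans ?_ (Finset.le_sup (Finset.mem_univ ∅))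
    simp
  | inf hp hq ihp ihq =>
    refine (inf_le_inf ihp ihq).trans ?_
    rw [Finset.sup_inf_sup]
    refine Finset.sup_le fun ST _ => ?_
    refine le_trans ?_ (Finset.le_sup (Finset.mem_univ (ST.1 ∪ ST.2)))
    rw [Finset.inf_union, inf_inf_inf_comm]
    exact inf_le_inf_right _ (inf_le_inf
      (hp.monotone_s11 (charVec_mono_s11 Finset.subset_union_left))
      (hq.monotone_s11 (charVec_mono_s11 Finset.subset_union_right)))
  | sup hp hq ihp ihq =>
    exact sup_le
      (ihp.trans (Finset.sup_mono_fun fun S _ => inf_le_inf_right _ le_sup_left))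
      (ihq.trans (Finset.sup_mono_fun fun S _ => inf_le_inf_right _ le_sup_right))

end IsWLP

/-- Any w.l.p. function `p` is a median of a Sugeno integral and the two values
`p (e_∅)` and `p (e_[n])`: there is an `L`-valued fuzzy measure `μ` on `[n]` with
`p x = median (p e_∅) (S_μ x) (p e_[n])`, where
`median a b c = (a ⊓ b) ⊔ (b ⊓ c) ⊔ (a ⊓ c)`. -/
theorem wlp_median_of_sugeno_integral
    {L : Type*} [DistribLattice L] [BoundedOrder L] {n : ℕ} (hn : 1 ≤ n)
    (p : (Fin n → L) → L) (hp : IsWLP p) :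
    ∃ μ : Finset (Fin n) → L,
      (∀ S T : Finset (Fin n), S ⊆ T → μ S ≤ μ T) ∧
      μ ∅ = ⊥ ∧ μ Finset.univ = ⊤ ∧
      ∀ x : Fin n → L,
        p x =
          (p (charVec L ∅) ⊓ Finset.univ.sup (fun S : Finset (Fin n) => μ S ⊓ S.inf x)) ⊔
          (Finset.univ.sup (fun S : Finset (Fin n) => μ S ⊓ S.inf x) ⊓ p (charVec L Finset.univ)) ⊔
          (p (charVec L ∅) ⊓ p (charVec L Finset.univ)) := by
  have : NeZero n := ⟨by omega⟩
  have hne : (Finset.univ : Finset (Fin n)) ≠ ∅ := Finset.univ_nonempty.ne_empty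
  have hmono {S T : Finset (Fin n)} (h : S ⊆ T) : p (charVec L S) ≤ p (charVec L T) :=
    hp.monotone_s11 (IsWLP.charVec_mono_s11 h)
  let μ (S : Finset (Fin n)) : L :=
    if S = ∅ then ⊥ else if S = Finset.univ then ⊤ else p (charVec L S)
  have hμ_inf (S : Finset (Fin n)) :
      μ S ⊓ p (charVec L Finset.univ) ≤ p (charVec L S) := by
    by_cases h₀ : S = ∅
    · simp [μ, h₀]
    by_cases h₁ : S = Finset.univ
    · simp [h₁]
    · simp [μ, h₀, h₁]
  have hle_μ {S : Finset (Fin n)} (h₀ : S ≠ ∅) : p (charVec L S) ≤ μ S := by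
    by_cases h₁ : S = Finset.univ
    · simp [μ, h₁, hne]
    · simp [μ, h₀, h₁]
  refine ⟨μ, fun S T hST => ?_, by simp [μ], by simp [μ, hne], fun x => ?_⟩
  · by_cases hS₀ : S = ∅
    · simp [μ, hS₀]
    have hT₀ : T ≠ ∅ := fun h => hS₀ (Finset.subset_empty.mp (h ▸ hST))
    by_cases hT₁ : T = Finset.univ
    · simp [μ, hT₁, hne]
    have hS₁ : S ≠ Finset.univ := fun h => hT₁ (Finset.univ_subset_iff.mp (h ▸ hST))
    simpa [μ, hS₀, hT₀, hS₁, hT₁] using hmono hST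
  · have hbot : p (charVec L ∅) ≤ p x := by
      simpa using hp.apply_charVec_inf_le ∅ x
    apply le_antisymm
    · rw [hp.eq_sup_charVec x]
      refine Finset.sup_le fun S _ => ?_
      by_cases h₀ : S = ∅
      · subst h₀
        exact le_sup_of_le_right
          (inf_le_left.trans (le_inf le_rfl (hmono (Finset.empty_subset _))))
      · refine le_sup_of_le_left (le_sup_of_le_right (le_inf ?_ ?_))
        · exact (inf_le_inf_right _ (hle_μ h₀)).trans
            (Finset.le_sup (f := fun S => μ S ⊓ S.inf x) (Finset.mem_univ S))
        · exact inf_le_left.trans (hmono (Finset.subset_univ S))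
    · refine sup_le (sup_le (inf_le_left.trans hbot) ?_) (inf_le_left.trans hbot)
      rw [Finset.sup_inf_distrib_right]
      refine Finset.sup_le fun S _ => ?_
      rw [inf_right_comm]
      exact (inf_le_inf_right _ (hμ_inf S)).trans (hp.apply_charVec_inf_le S x)
end

section
/- Let L be a bounded totally ordered lattice, n ≥ 1, let p : L^n → L be a weighted lattice polynomial function, let σ be a permutation of [n], and let x ∈ L^n satisfy x_{σ(1)} ≤ x_{σ(2)} ≤ … ≤ x_{σ(n)}. Setting S_σ(i) := {σ(i), σ(i+1), …, σ(n)} for i ∈ [n], S_σ(n+1) := ∅, x_{σ(0)} := 0, and α_p(S) := p(e_S), one has p(x) = ⋀_{i=0}^{n} ( α_p(S_σ(i+1)) ∨ x_{σ(i)} ). -/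
theorem IsWLP.le_sup_const {L : Type*} [DistribLattice L] {n : ℕ} {p : (Fin n → L) → L}
    (hp : IsWLP p) {x y : Fin n → L} {c : L} (h : ∀ j, x j ≤ y j ⊔ c) : p x ≤ p y ⊔ c := by
  induction hp with
  | proj k => exact h k
  | const d => exact le_sup_left
  | inf _ _ ihp ihq => rw [sup_inf_right]; exact inf_le_inf ihp ihq
  | sup _ _ ihp ihq => rw [sup_sup_distrib_right]; exact sup_le_sup ihp ihq

theorem IsWLP.inf_const_le {L : Type*} [DistribLattice L] {n : ℕ} {p : (Fin n → L) → L}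
    (hp : IsWLP p) {x y : Fin n → L} {c : L} (h : ∀ j, x j ⊓ c ≤ y j) : p x ⊓ c ≤ p y := by
  induction hp with
  | proj k => exact h k
  | const d => exact inf_le_left
  | inf _ _ ihp ihq => rw [inf_inf_distrib_right]; exact inf_le_inf ihp ihq
  | sup _ _ ihp ihq => rw [inf_sup_right]; exact sup_le_sup ihp ihq

theorem mem_image_filter_le_iff {n : ℕ} (σ : Equiv.Perm (Fin n)) (m : ℕ) (j : Fin n) :
    σ j ∈ (Finset.univ.filter (fun j : Fin n => m ≤ (j : ℕ))).image σ ↔ m ≤ (j : ℕ) := by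
  simp

/-- Representation theorem (conjunctive form on an ordered simplex). On a bounded
chain, if `x_{σ(1)} ≤ ⋯ ≤ x_{σ(n)}`, then
`p x = ⋀_{i=0}^{n} (α_p (S_σ(i+1)) ⊔ x_{σ(i)})`, where `S_σ(i) = {σ(i), …, σ(n)}`,
`S_σ(n+1) = ∅`, `x_{σ(0)} = 0`, and `α_p S = p (e_S)`.
(Here indices `i : Fin (n+1)` correspond to the paper's indices `i ∈ {0, …, n}`, so
`S_σ(i+1)` is the image under `σ` of the paper indices `≥ i+1`, i.e. Lean indices `≥ i`.) -/
theorem wlp_representation_inf_on_simplex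
    {L : Type*} [LinearOrder L] [BoundedOrder L] {n : ℕ} (hn : 1 ≤ n)
    (p : (Fin n → L) → L) (hp : IsWLP p)
    (σ : Equiv.Perm (Fin n)) (x : Fin n → L)
    (hx : ∀ i j : Fin n, i ≤ j → x (σ i) ≤ x (σ j)) :
    p x = Finset.univ.inf (fun i : Fin (n + 1) =>
      p (charVec L ((Finset.univ.filter (fun j : Fin n => (i : ℕ) ≤ (j : ℕ))).image σ)) ⊔
      (if h : 0 < (i : ℕ) then x (σ ⟨(i : ℕ) - 1, by have := i.isLt; omega⟩) else ⊥)) := by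
  apply le_antisymm
  · refine Finset.le_inf fun i _ => hp.le_sup_const fun k => ?_
    obtain ⟨j, rfl⟩ := σ.surjective k
    simp only [charVec, mem_image_filter_le_iff]
    by_cases hij : (i : ℕ) ≤ j
    · simp [hij]
    · rw [dif_pos (by omega)]
      exact le_sup_of_le_right (hx _ _ (Fin.le_def.2 (by simp only; omega)))
  · by_contra! hlt
    have hfactor := fun i => hlt.trans_le (Finset.inf_le (Finset.mem_univ i))
    have hcoord : ∀ i : Fin (n + 1),
        (if h : 0 < (i : ℕ) then x (σ ⟨(i : ℕ) - 1, by have := i.isLt; omega⟩) else ⊥) ≤ p x := by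
      intro i
      induction i using Fin.induction with
      | zero => simp
      | succ i ih =>
        have hα := (lt_sup_iff.1 (hfactor i.castSucc)).resolve_right ih.not_gt
        have hmin := hp.inf_const_le (y := x) (c := x (σ i))
          (x := charVec L ((Finset.univ.filter
            (fun j : Fin n => (i.castSucc : ℕ) ≤ (j : ℕ))).image σ)) fun k => by
            obtain ⟨j, rfl⟩ := σ.surjective k
            simp only [charVec, mem_image_filter_le_iff]
            split_ifs with hij
            · exact inf_le_of_right_le (hx _ _ hij)
            · simp
        simpa using (inf_le_iff.1 hmin).resolve_left hα.not_ge
    have hα := (lt_sup_iff.1 (hfactor (Fin.last n))).resolve_right (hcoord _).not_gt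
    have hle := hp.inf_const_le (y := x) (c := ⊤)
      (x := charVec L ((Finset.univ.filter
        (fun j : Fin n => (Fin.last n : ℕ) ≤ (j : ℕ))).image σ)) fun k => by
        obtain ⟨j, rfl⟩ := σ.surjective k
        simp [charVec, j.isLt.not_ge]
    rw [inf_top_eq] at hle
    exact hα.not_ge hle
end

section
/- Let L be a bounded totally ordered lattice, n ≥ 1, let μ be an L-valued fuzzy measure on [n], let σ be a permutation of [n], and let x ∈ L^n satisfy x_{σ(1)} ≤ x_{σ(2)} ≤ … ≤ x_{σ(n)}. Setting S_σ(i) := {σ(i), σ(i+1), …, σ(n)} for i ∈ [n] and S_σ(n+1) := ∅, one has S_μ(x) = ⋁_{i=1}^{n} ( μ(S_σ(i)) ∧ x_{σ(i)} ) = ⋀_{i=1}^{n} ( μ(S_σ(i+1)) ∨ x_{σ(i)} ). -/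
/-- The set `{σ(k), …, σ(n-1)}` of the images of the indices that are at least `k`. -/
def upperImage {n : ℕ} (σ : Equiv.Perm (Fin n)) (k : ℕ) : Finset (Fin n) :=
  (Finset.univ.filter (fun j : Fin n => k ≤ (j : ℕ))).image σ

lemma apply_mem_upperImage {n : ℕ} (σ : Equiv.Perm (Fin n)) (k : ℕ) (j : Fin n) :
    σ j ∈ upperImage σ k ↔ k ≤ (j : ℕ) := by
  simp [upperImage]

lemma upperImage_zero {n : ℕ} (σ : Equiv.Perm (Fin n)) : upperImage σ 0 = Finset.univ := by
  simp [upperImage]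

lemma upperImage_self {n : ℕ} (σ : Equiv.Perm (Fin n)) : upperImage σ n = ∅ := by
  simp [upperImage]

lemma subset_upperImage_iff {n : ℕ} (σ : Equiv.Perm (Fin n)) (k : ℕ) (S : Finset (Fin n)) :
    S ⊆ upperImage σ k ↔ ∀ j, σ j ∈ S → k ≤ (j : ℕ) := by
  rw [Finset.subset_iff, ← σ.forall_congr_right]
  simp only [apply_mem_upperImage]

section

variable {L : Type*} [LinearOrder L] [BoundedOrder L] {n : ℕ} {μ : Finset (Fin n) → L}
  {σ : Equiv.Perm (Fin n)} {x : Fin n → L}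

lemma sugeno_le_sup_upperImage (hmono : ∀ S T : Finset (Fin n), S ⊆ T → μ S ≤ μ T)
    (hμ0 : μ ∅ = ⊥) :
    Finset.univ.sup (fun S : Finset (Fin n) => μ S ⊓ S.inf x) ≤
      Finset.univ.sup (fun i : Fin n => μ (upperImage σ i) ⊓ x (σ i)) := by
  refine Finset.sup_le fun S _ => ?_
  rcases S.eq_empty_or_nonempty with rfl | hS
  · simp [hμ0]
  obtain ⟨i, hi, hmin⟩ := (S.image σ.symm).exists_min_image id (hS.image _)
  have hiS : σ i ∈ S := by
    obtain ⟨s, hs, rfl⟩ := Finset.mem_image.1 hi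
    simpa using hs
  have hsub : S ⊆ upperImage σ i := (subset_upperImage_iff σ i S).2 fun j hj =>
    hmin j (Finset.mem_image.2 ⟨σ j, hj, by simp⟩)
  exact (inf_le_inf (hmono _ _ hsub) (Finset.inf_le hiS)).trans
    (Finset.le_sup (f := fun i : Fin n => μ (upperImage σ i) ⊓ x (σ i)) (Finset.mem_univ i))

lemma sup_upperImage_le_sugeno (hx : ∀ i j : Fin n, i ≤ j → x (σ i) ≤ x (σ j)) :
    Finset.univ.sup (fun i : Fin n => μ (upperImage σ i) ⊓ x (σ i)) ≤
      Finset.univ.sup (fun S : Finset (Fin n) => μ S ⊓ S.inf x) := by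
  refine Finset.sup_le fun i _ => ?_
  have hinf : x (σ i) ≤ (upperImage σ i).inf x := by
    refine Finset.le_inf fun s hs => ?_
    obtain ⟨j, rfl⟩ := σ.surjective s
    exact hx i j ((apply_mem_upperImage σ i j).1 hs)
  exact (inf_le_inf_left _ hinf).trans
    (Finset.le_sup (f := fun S : Finset (Fin n) => μ S ⊓ S.inf x) (Finset.mem_univ _))

lemma sugeno_le_inf_upperImage (hmono : ∀ S T : Finset (Fin n), S ⊆ T → μ S ≤ μ T)
    (hx : ∀ i j : Fin n, i ≤ j → x (σ i) ≤ x (σ j)) :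
    Finset.univ.sup (fun S : Finset (Fin n) => μ S ⊓ S.inf x) ≤
      Finset.univ.inf (fun i : Fin n => μ (upperImage σ (i + 1)) ⊔ x (σ i)) := by
  refine Finset.sup_le fun S _ => Finset.le_inf fun i _ => ?_
  by_cases hS : S ⊆ upperImage σ (i + 1)
  · exact inf_le_left.trans ((hmono _ _ hS).trans le_sup_left)
  · rw [subset_upperImage_iff] at hS
    push Not at hS
    obtain ⟨j, hjS, hji⟩ := hS
    exact inf_le_right.trans ((Finset.inf_le hjS).trans
      ((hx j i (Nat.lt_succ_iff.1 hji)).trans le_sup_right))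

lemma inf_upperImage_le_sup_upperImage (hμ0 : μ ∅ = ⊥) (hμ1 : μ Finset.univ = ⊤) :
    Finset.univ.inf (fun i : Fin n => μ (upperImage σ (i + 1)) ⊔ x (σ i)) ≤
      Finset.univ.sup (fun i : Fin n => μ (upperImage σ i) ⊓ x (σ i)) := by
  set B := Finset.univ.sup (fun i : Fin n => μ (upperImage σ i) ⊓ x (σ i)) with hB
  by_contra! h
  have key : ∀ k ≤ n, B < μ (upperImage σ k) := by
    intro k
    induction k with
    | zero =>
      intro _
      rw [upperImage_zero, hμ1]
      exact h.trans_le le_top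
    | succ k ih =>
      intro hk
      have hle : μ (upperImage σ k) ⊓ x (σ ⟨k, hk⟩) ≤ B :=
        Finset.le_sup (f := fun i : Fin n => μ (upperImage σ i) ⊓ x (σ i))
          (Finset.mem_univ ⟨k, hk⟩)
      have hlt : B < μ (upperImage σ (k + 1)) ⊔ x (σ ⟨k, hk⟩) :=
        h.trans_le (Finset.inf_le (f := fun i : Fin n => μ (upperImage σ (i + 1)) ⊔ x (σ i))
          (Finset.mem_univ ⟨k, hk⟩))
      have hxB : x (σ ⟨k, hk⟩) ≤ B := (inf_le_iff.1 hle).resolve_left (ih (by omega)).not_ge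
      exact (lt_sup_iff.1 hlt).resolve_right hxB.not_gt
  have hn := key n le_rfl
  rw [upperImage_self, hμ0] at hn
  exact not_lt_bot hn

end

/-- Representations of the Sugeno integral on an ordered simplex. On a bounded
chain, for an `L`-valued fuzzy measure `μ` on `[n]` and `x` with
`x_{σ(1)} ≤ ⋯ ≤ x_{σ(n)}`,
`S_μ(x) = ⋁_{i=1}^{n} (μ (S_σ(i)) ⊓ x_{σ(i)}) = ⋀_{i=1}^{n} (μ (S_σ(i+1)) ⊔ x_{σ(i)})`,
where `S_σ(i) = {σ(i), …, σ(n)}` and `S_σ(n+1) = ∅`.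
(Indices `i : Fin n` correspond to the paper's indices `i+1 ∈ {1, …, n}`.) -/
theorem sugeno_integral_representations_on_simplex
    {L : Type*} [LinearOrder L] [BoundedOrder L] {n : ℕ} (hn : 1 ≤ n)
    (μ : Finset (Fin n) → L)
    (hmono : ∀ S T : Finset (Fin n), S ⊆ T → μ S ≤ μ T)
    (hμ0 : μ ∅ = ⊥) (hμ1 : μ Finset.univ = ⊤)
    (σ : Equiv.Perm (Fin n)) (x : Fin n → L)
    (hx : ∀ i j : Fin n, i ≤ j → x (σ i) ≤ x (σ j)) :
    Finset.univ.sup (fun S : Finset (Fin n) => μ S ⊓ S.inf x) =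
      Finset.univ.sup (fun i : Fin n =>
        μ ((Finset.univ.filter (fun j : Fin n => (i : ℕ) ≤ (j : ℕ))).image σ) ⊓ x (σ i)) ∧
    Finset.univ.sup (fun S : Finset (Fin n) => μ S ⊓ S.inf x) =
      Finset.univ.inf (fun i : Fin n =>
        μ ((Finset.univ.filter (fun j : Fin n => (i : ℕ) + 1 ≤ (j : ℕ))).image σ) ⊔ x (σ i)) := by
  have hsup := le_antisymm (sugeno_le_sup_upperImage (σ := σ) (x := x) hmono hμ0)
    (sup_upperImage_le_sugeno hx)
  exact ⟨hsup, le_antisymm (sugeno_le_inf_upperImage hmono hx)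
    ((inf_upperImage_le_sup_upperImage hμ0 hμ1).trans hsup.ge)⟩
end

section
/- Let L be a bounded distributive lattice and n ≥ 1. For every weighted lattice polynomial function p : L^n → L, every k ∈ [n], and every x ∈ L^n, one has p(x_1, …, x_{k−1}, p(x), x_{k+1}, …, x_n) = p(x); i.e., substituting the value p(x) for the k-th argument leaves the value of p unchanged. -/
/-- As a function of a single argument, a w.l.p. function has the form `t ↦ a ⊔ (t ⊓ b)`. -/
theorem IsWLP.exists_update_eq_sup_inf {L : Type*} [DistribLattice L] [BoundedOrder L] {n : ℕ}
    {p : (Fin n → L) → L} (hp : IsWLP p) (k : Fin n) (x : Fin n → L) :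
    ∃ a b : L, ∀ t, p (Function.update x k t) = a ⊔ (t ⊓ b) := by
  induction hp with
  | proj j =>
    by_cases h : j = k
    · subst h
      exact ⟨⊥, ⊤, fun t => by simp⟩
    · exact ⟨x j, ⊥, fun t => by simp [h]⟩
  | const c => exact ⟨c, ⊥, fun t => by simp⟩
  | inf _ _ ihp ihq =>
    obtain ⟨a, b, h⟩ := ihp
    obtain ⟨c, d, h'⟩ := ihq
    refine ⟨a ⊓ c, a ⊓ d ⊔ b ⊓ c ⊔ b ⊓ d, fun t => ?_⟩
    simp only [h, h', inf_sup_left, inf_sup_right]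
    ac_rfl
  | sup _ _ ihp ihq =>
    obtain ⟨a, b, h⟩ := ihp
    obtain ⟨c, d, h'⟩ := ihq
    refine ⟨a ⊔ c, b ⊔ d, fun t => ?_⟩
    simp only [h, h', inf_sup_left]
    ac_rfl

/-- Substituting the value `p x` for the `k`-th argument of a w.l.p. function `p`
leaves the value unchanged. -/
theorem wlp_substitute_value_invariance
    {L : Type*} [DistribLattice L] [BoundedOrder L] {n : ℕ} (hn : 1 ≤ n)
    (p : (Fin n → L) → L) (hp : IsWLP p) (k : Fin n) (x : Fin n → L) :
    p (Function.update x k (p x)) = p x := by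
  obtain ⟨a, b, h⟩ := hp.exists_update_eq_sup_inf k x
  have hx : p x = a ⊔ (x k ⊓ b) := by
    simpa only [Function.update_eq_self] using h (x k)
  rw [h, hx, inf_sup_right, ← sup_assoc, sup_inf_self, inf_assoc, inf_idem]
end
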